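/- Suppose Λ±, r±, ℓ± are smooth eigenvalue, right-eigenvector and left-eigenvector fields of Df on a neighborhood of 0 with ℓ∓(u) · r±(u) ≡ 0 and ℓ∓(u) · r∓(u) ≡ 1. Then ℓ∓(0) · b± = (Λ±(0) − Λ∓(0)) · (((r± · ∇)r±) · ℓ∓)(0). Consequently, with δΛ := Λ⁺(0) − Λ⁻(0), A := |det(r₋(0), r₊(0))|, and κ± := A · (((r± · ∇)r±) · ℓ∓)(0), one has the decomposition b± = (∇Λ± · r±)(0) r±(0) ± (κ± δΛ / A) r∓(0). -/

import Mathlib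

noncomputable section

/-- The state space `ℝ²`, with the Euclidean norm. -/
abbrev E2 : Type := EuclideanSpace ℝ (Fin 2)

/-- Dot product on `ℝ²`. -/
def dot2 (a b : E2) : ℝ := a 0 * b 0 + a 1 * b 1

/-- Determinant of the `2×2` matrix with columns `a, b`. -/
def det2 (a b : E2) : ℝ := a 0 * b 1 - a 1 * b 0

lemma key_deriv (V : Set E2) (f : E2 → E2) (L : E2 → ℝ) (r : E2 → E2)
    (hVopen : IsOpen V) (hV0 : (0 : E2) ∈ V)
    (hf : ContDiffOn ℝ (⊤ : ℕ∞) f V) (hL : ContDiffOn ℝ (⊤ : ℕ∞) L V)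
    (hr : ContDiffOn ℝ (⊤ : ℕ∞) r V)
    (hE : ∀ v ∈ V, fderiv ℝ f v (r v) = L v • r v) :
    iteratedFDeriv ℝ 2 f 0 ![r 0, r 0] + fderiv ℝ f 0 (fderiv ℝ r 0 (r 0))
      = L 0 • fderiv ℝ r 0 (r 0) + fderiv ℝ L 0 (r 0) • r 0 := by
  have hV : V ∈ nhds (0 : E2) := hVopen.mem_nhds hV0
  have hf0 : ContDiffAt ℝ (⊤ : ℕ∞) f 0 := hf.contDiffAt hV
  have hdf : DifferentiableAt ℝ (fderiv ℝ f) 0 :=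
    (hf0.fderiv_right (m := 1) (by norm_cast)).differentiableAt (by norm_num)
  have hdL : DifferentiableAt ℝ L 0 := (hL.contDiffAt hV).differentiableAt (by simp)
  have hdr : DifferentiableAt ℝ r 0 := (hr.contDiffAt hV).differentiableAt (by simp)
  have h1 := hdf.hasFDerivAt.clm_apply hdr.hasFDerivAt
  have h2 := hdL.hasFDerivAt.smul hdr.hasFDerivAt
  have heq : (fun v => fderiv ℝ f v (r v)) =ᶠ[nhds 0] (fun v => L v • r v) :=
    Filter.eventually_of_mem hV hE
  have h3 := (h1.congr_of_eventuallyEq heq.symm).unique h2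
  have h4 := congrArg (fun T => T (r 0)) h3
  rw [iteratedFDeriv_two_apply]
  simp at h4 ⊢
  rw [← h4, add_comm]

lemma dot2_add (a b c : E2) : dot2 a (b + c) = dot2 a b + dot2 a c := by
  simp [dot2]; ring

lemma dot2_smul (a b : E2) (t : ℝ) : dot2 a (t • b) = t * dot2 a b := by
  simp [dot2]; ring

lemma dot2_comm (a b : E2) : dot2 a b = dot2 b a := by
  simp [dot2]; ring

lemma det_mul (a b c d : E2) (h1 : dot2 a c = 1) (h2 : dot2 b d = 1) (h3 : dot2 a d = 0) :
    det2 a b * det2 c d = 1 := by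
  have : det2 a b * det2 c d = dot2 a c * dot2 b d - dot2 a d * dot2 b c := by
    simp [dot2, det2]; ring
  rw [this, h1, h2, h3]; ring

lemma eq_of_dots (a b z w : E2) (h : det2 a b ≠ 0) (ha : dot2 a z = dot2 a w)
    (hb : dot2 b z = dot2 b w) : z = w := by
  simp only [dot2, det2] at *
  ext i
  apply mul_left_cancel₀ h
  fin_cases i
  · simp [-mul_eq_mul_left_iff]; linear_combination b 1 * ha - a 1 * hb
  · simp [-mul_eq_mul_left_iff]; linear_combination a 0 * hb - b 0 * ha

/-- for smooth eigenvalue, unit right-eigenvector and left-eigenvector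
fields `Λ±, r±, ℓ±` of `Df` with `ℓ∓(u)·r±(u) ≡ 0` and `ℓ∓(u)·r∓(u) ≡ 1`, one has
`ℓ∓(0)·b± = (Λ±(0) − Λ∓(0)) · (((r±·∇)r±)·ℓ∓)(0)`, and consequently, with
`δΛ := Λ⁺(0) − Λ⁻(0)`, `A := |det(r₋(0), r₊(0))|` and `κ± := A·(((r±·∇)r±)·ℓ∓)(0)`,
the decomposition `b± = (∇Λ±·r±)(0) r±(0) ± (κ± δΛ / A) r∓(0)` holds, where
`b± = D²f(0):(r±(0) ⊗ r±(0))`. -/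
theorem off_diagonal_component_and_decomposition_of_b
    (V : Set E2) (f : E2 → E2) (Λm Λp : E2 → ℝ) (rm rp lm lp : E2 → E2)
    (hVopen : IsOpen V) (hV0 : (0 : E2) ∈ V)
    (hf : ContDiffOn ℝ (⊤ : ℕ∞) f V)
    (hΛm : ContDiffOn ℝ (⊤ : ℕ∞) Λm V) (hΛp : ContDiffOn ℝ (⊤ : ℕ∞) Λp V)
    (hrm : ContDiffOn ℝ (⊤ : ℕ∞) rm V) (hrp : ContDiffOn ℝ (⊤ : ℕ∞) rp V)
    (hlm : ContDiffOn ℝ (⊤ : ℕ∞) lm V) (hlp : ContDiffOn ℝ (⊤ : ℕ∞) lp V)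
    (hhyp : ∀ v ∈ V, Λm v < Λp v)
    (hrmU : ∀ v ∈ V, ‖rm v‖ = 1) (hrpU : ∀ v ∈ V, ‖rp v‖ = 1)
    (hrmE : ∀ v ∈ V, fderiv ℝ f v (rm v) = Λm v • rm v)
    (hrpE : ∀ v ∈ V, fderiv ℝ f v (rp v) = Λp v • rp v)
    (hlmE : ∀ v ∈ V, ∀ w : E2, dot2 (lm v) (fderiv ℝ f v w) = Λm v * dot2 (lm v) w)
    (hlpE : ∀ v ∈ V, ∀ w : E2, dot2 (lp v) (fderiv ℝ f v w) = Λp v * dot2 (lp v) w)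
    (hlm1 : ∀ v ∈ V, dot2 (lm v) (rm v) = 1)
    (hlp1 : ∀ v ∈ V, dot2 (lp v) (rp v) = 1)
    (hlm0 : ∀ v ∈ V, dot2 (lm v) (rp v) = 0)
    (hlp0 : ∀ v ∈ V, dot2 (lp v) (rm v) = 0) :
    dot2 (lm 0) (iteratedFDeriv ℝ 2 f 0 ![rp 0, rp 0])
        = (Λp 0 - Λm 0) * dot2 (fderiv ℝ rp 0 (rp 0)) (lm 0) ∧
    dot2 (lp 0) (iteratedFDeriv ℝ 2 f 0 ![rm 0, rm 0])
        = (Λm 0 - Λp 0) * dot2 (fderiv ℝ rm 0 (rm 0)) (lp 0) ∧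
    iteratedFDeriv ℝ 2 f 0 ![rp 0, rp 0]
        = fderiv ℝ Λp 0 (rp 0) • rp 0
          + ((|det2 (rm 0) (rp 0)| * dot2 (fderiv ℝ rp 0 (rp 0)) (lm 0))
              * (Λp 0 - Λm 0) / |det2 (rm 0) (rp 0)|) • rm 0 ∧
    iteratedFDeriv ℝ 2 f 0 ![rm 0, rm 0]
        = fderiv ℝ Λm 0 (rm 0) • rm 0
          - ((|det2 (rm 0) (rp 0)| * dot2 (fderiv ℝ rm 0 (rm 0)) (lp 0))
              * (Λp 0 - Λm 0) / |det2 (rm 0) (rp 0)|) • rp 0 := by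
  have kp := key_deriv V f Λp rp hVopen hV0 hf hΛp hrp hrpE
  have km := key_deriv V f Λm rm hVopen hV0 hf hΛm hrm hrmE
  have hdet := det_mul _ _ _ _ (hlm1 0 hV0) (hlp1 0 hV0) (hlm0 0 hV0)
  have hL : det2 (lm 0) (lp 0) ≠ 0 := left_ne_zero_of_mul_eq_one hdet
  have hR : |det2 (rm 0) (rp 0)| ≠ 0 := abs_ne_zero.2 (right_ne_zero_of_mul_eq_one hdet)
  have a1 := congrArg (dot2 (lm 0)) kp
  have a2 := congrArg (dot2 (lp 0)) kp
  have a3 := congrArg (dot2 (lm 0)) km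
  have a4 := congrArg (dot2 (lp 0)) km
  simp only [dot2_add, dot2_smul, hlmE 0 hV0, hlpE 0 hV0, hlm1 0 hV0, hlp1 0 hV0,
    hlm0 0 hV0, hlp0 0 hV0] at a1 a2 a3 a4
  rw [dot2_comm _ (lm 0), dot2_comm _ (lp 0), mul_assoc, mul_div_cancel_left₀ _ hR,
    mul_assoc, mul_div_cancel_left₀ _ hR, sub_eq_add_neg (_ • rm 0), ← neg_smul]
  refine ⟨by linarith, by linarith, ?_, ?_⟩ <;> apply eq_of_dots _ _ _ _ hL <;>
    simp only [dot2_add, dot2_smul, hlm1 0 hV0, hlp1 0 hV0, hlm0 0 hV0, hlp0 0 hV0] <;>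
    linarith
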